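/- arXiv:1811.05075 — 2 statements merged into one kernel-verified Lean document; each statement's English description precedes it below -/
import Mathlib

section
/- For μ-almost every x ∈ X = supp(μ), the lower local dimension equals d̲(μ,x) = H(p)/log A. -/
open MeasureTheory Filter Set Metric Topology

/-- `moranCyl c w n (x, ℓ)` refines the interval `[x, x + ℓ]` along the binary word `w`,
using the contraction ratio `c k` at step `k` (the first letter of `w` is processed with
index `n`).  The result `(x', ℓ')` describes the interval `[x', x' + ℓ']`. -/
noncomputable def moranCyl (c : ℕ → ℝ) : List Bool → ℕ → ℝ × ℝ → ℝ × ℝ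
  | [], _, st => st
  | bb :: w, n, st =>
      moranCyl c w (n + 1)
        (if bb then (st.1 + st.2 - st.2 / c n, st.2 / c n) else (st.1, st.2 / c n))

/-- The basic interval `I_w` of the Moran construction with ratios `c`. -/
noncomputable def moranI (c : ℕ → ℝ) (w : List Bool) : Set ℝ :=
  Icc (moranCyl c w 1 (0, 1)).1 ((moranCyl c w 1 (0, 1)).1 + (moranCyl c w 1 (0, 1)).2)

/-- The length `|I_w|` of the basic interval `I_w`. -/
noncomputable def moranLen (c : ℕ → ℝ) (w : List Bool) : ℝ :=
  (moranCyl c w 1 (0, 1)).2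

/-- The Moran set `⋂ n ⋃ {I_w : |w| = n}`. -/
noncomputable def moranSet (c : ℕ → ℝ) : Set ℝ :=
  ⋂ n : ℕ, ⋃ w ∈ {w : List Bool | w.length = n}, moranI c w

/-- The mass assigned to the cylinder `I_w` by the Moran measure with weight `r k` for the
letter at step `k`: `cylMass r w 1 1 = μ(I_w)`. -/
noncomputable def cylMass (r : ℕ → ℝ) : List Bool → ℕ → ℝ → ℝ
  | [], _, m => m
  | bb :: w, n, m => cylMass r w (n + 1) (if bb then (1 - r n) * m else r n * m)

/-- Lower local dimension `liminf_{r → 0⁺} log μ(B(x,r)) / log r`. -/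
noncomputable def lowerLocalDim (μ : Measure ℝ) (x : ℝ) : ℝ :=
  liminf (fun rr : ℝ => Real.log (μ (closedBall x rr)).toReal / Real.log rr) (𝓝[>] 0)

/-- Upper local dimension `limsup_{r → 0⁺} log μ(B(x,r)) / log r`. -/
noncomputable def upperLocalDim (μ : Measure ℝ) (x : ℝ) : ℝ :=
  limsup (fun rr : ℝ => Real.log (μ (closedBall x rr)).toReal / Real.log rr) (𝓝[>] 0)

/-- `betaFn ρ C s = -log (ρ^s + (1-ρ)^s) / log C`; so `β₁ = betaFn p A`, `β₂ = betaFn q B`. -/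
noncomputable def betaFn (ρ C : ℝ) (s : ℝ) : ℝ :=
  -Real.log (ρ ^ s + (1 - ρ) ^ s) / Real.log C

/-- The Legendre transform `f^*(α) = inf_s (s α - f(s))`. -/
noncomputable def legendre (f : ℝ → ℝ) (α : ℝ) : ℝ :=
  ⨅ s : ℝ, (s * α - f s)

/-- The modification `β̃₁` of `β₁`, linear on `(0,1)`. -/
noncomputable def betaTilde1 (ρ C : ℝ) (s : ℝ) : ℝ :=
  if s ≤ 0 ∨ 1 ≤ s then betaFn ρ C s
  else (1 - s) * betaFn ρ C 0 + s * betaFn ρ C 1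

/-- `packSup μ X r s` is the supremum of `∑ᵢ μ(B(xᵢ,r))^s` over all finite families of
pairwise disjoint closed balls of radius `r` with centers in `X`. -/
noncomputable def packSup (μ : Measure ℝ) (X : Set ℝ) (rr s : ℝ) : ℝ :=
  sSup {y : ℝ | ∃ t : Finset ℝ, (↑t : Set ℝ) ⊆ X ∧
    (↑t : Set ℝ).Pairwise (fun u v => Disjoint (closedBall u rr) (closedBall v rr)) ∧
    y = ∑ u ∈ t, (μ (closedBall u rr)).toReal ^ s}

/-- The finite set of binary words of length `n`. -/
def binWords : ℕ → Finset (List Bool)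
  | 0 => {[]}
  | n + 1 => (binWords n).image (List.cons true) ∪ (binWords n).image (List.cons false)

lemma mem_binWords {n : ℕ} {w : List Bool} : w ∈ binWords n ↔ w.length = n := by
  induction n generalizing w with
  | zero => simp [binWords]
  | succ n ih =>
    cases w with
    | nil => simp [binWords]
    | cons b w => cases b <;> simp [binWords, ih]

lemma sum_binWords_succ (n : ℕ) (f : List Bool → ℝ) :
    ∑ w ∈ binWords (n + 1), f w =
      ∑ w ∈ binWords n, f (true :: w) + ∑ w ∈ binWords n, f (false :: w) := by
  rw [binWords, Finset.sum_union, Finset.sum_image (by simp), Finset.sum_image (by simp)]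
  rw [Finset.disjoint_left]
  simp

lemma cylMass_pos {r : ℕ → ℝ} (hr : ∀ k, 1 ≤ k → 0 < r k ∧ r k < 1) (w : List Bool) {n : ℕ}
    (hn : 1 ≤ n) {m : ℝ} (hm : 0 < m) : 0 < cylMass r w n m := by
  induction w generalizing n m with
  | nil => simpa [cylMass]
  | cons b w ih =>
    obtain ⟨h0, h1⟩ := hr n hn
    rw [cylMass]
    apply ih (by omega)
    split_ifs
    · exact mul_pos (by linarith) hm
    · exact mul_pos h0 hm

lemma sum_cylMass_rpow {r : ℕ → ℝ} (hr : ∀ k, 1 ≤ k → 0 < r k ∧ r k < 1) (s : ℝ) (l : ℕ) {n : ℕ}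
    (hn : 1 ≤ n) {m : ℝ} (hm : 0 < m) :
    ∑ w ∈ binWords l, cylMass r w n m ^ s =
      m ^ s * ∏ k ∈ Finset.range l, (r (n + k) ^ s + (1 - r (n + k)) ^ s) := by
  induction l generalizing n m with
  | zero => simp [binWords, cylMass]
  | succ l ih =>
    obtain ⟨h0, h1⟩ := hr n hn
    have h1' : 0 < 1 - r n := by linarith
    simp only [sum_binWords_succ, cylMass, if_true, Bool.false_eq_true, if_false]
    rw [ih (by omega) (mul_pos h1' hm), ih (by omega) (mul_pos h0 hm), Finset.prod_range_succ',
      Real.mul_rpow h1'.le hm.le, Real.mul_rpow h0.le hm.le]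
    simp only [add_zero, add_assoc, add_comm 1]
    ring

lemma moranCyl_snd (c : ℕ → ℝ) (w : List Bool) (n : ℕ) (st : ℝ × ℝ) :
    (moranCyl c w n st).2 = st.2 / ∏ k ∈ Finset.range w.length, c (n + k) := by
  induction w generalizing n st with
  | nil => simp [moranCyl]
  | cons b w ih =>
    rw [moranCyl, ih, List.length_cons, Finset.prod_range_succ']
    simp only [add_zero, add_assoc, add_comm 1]
    split_ifs <;> rw [div_div, mul_comm]

lemma moranCyl_subset {c : ℕ → ℝ} (hc : ∀ k, 1 ≤ k → 2 < c k) (w : List Bool) {n : ℕ}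
    (hn : 1 ≤ n) {st : ℝ × ℝ} (hst : 0 ≤ st.2) :
    st.1 ≤ (moranCyl c w n st).1 ∧
      (moranCyl c w n st).1 + (moranCyl c w n st).2 ≤ st.1 + st.2 := by
  induction w generalizing n st with
  | nil => simp [moranCyl]
  | cons b w ih =>
    have hcn := hc n hn
    have h1 : st.2 / c n ≤ st.2 := div_le_self hst (by linarith)
    have h0 : 0 ≤ st.2 / c n := div_nonneg hst (by linarith)
    rw [moranCyl]
    cases b
    · obtain ⟨h, h'⟩ := ih (n := n + 1) (st := (st.1, st.2 / c n)) (by omega) h0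
      simp only [Bool.false_eq_true, if_false] at *
      exact ⟨h, by linarith⟩
    · obtain ⟨h, h'⟩ := ih (n := n + 1) (st := (st.1 + st.2 - st.2 / c n, st.2 / c n)) (by omega) h0
      simp only [if_true] at *
      exact ⟨by linarith, by linarith⟩

lemma moranCyl_separated {c : ℕ → ℝ} {B : ℝ} (hB : 2 < B) (hc : ∀ k, 1 ≤ k → B ≤ c k) (l : ℕ)
    {v w : List Bool} (hv : v.length = l + 1) (hw : w.length = l + 1) (hvw : v ≠ w) {n : ℕ}
    (hn : 1 ≤ n) {st : ℝ × ℝ} (hst : 0 ≤ st.2) {y z : ℝ}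
    (hy : y ∈ Icc (moranCyl c v n st).1 ((moranCyl c v n st).1 + (moranCyl c v n st).2))
    (hz : z ∈ Icc (moranCyl c w n st).1 ((moranCyl c w n st).1 + (moranCyl c w n st).2)) :
    (1 - 2 / B) * (st.2 / ∏ k ∈ Finset.range l, c (n + k)) ≤ |y - z| := by
  have hc2 : ∀ k, 1 ≤ k → 2 < c k := fun k hk => hB.trans_le (hc k hk)
  have hδ : 0 ≤ 1 - 2 / B := by
    rw [sub_nonneg, div_le_one (by linarith)]; exact hB.le
  induction l using Nat.strong_induction_on generalizing v w n st with
  | _ l ih =>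
    have hprod : ∀ m, 1 ≤ ∏ k ∈ Finset.range m, c (n + k) := fun m =>
      Finset.one_le_prod fun k _ => by linarith [hc2 (n + k) (by omega)]
    have hcn := hc n hn
    have hc0 : 0 ≤ st.2 / c n := div_nonneg hst (by linarith)
    obtain ⟨a, v, rfl⟩ := List.exists_cons_of_length_eq_add_one hv
    obtain ⟨b, w, rfl⟩ := List.exists_cons_of_length_eq_add_one hw
    have hgap : (1 - 2 / B) * (st.2 / ∏ k ∈ Finset.range l, c (n + k)) ≤
        st.2 - 2 * (st.2 / c n) := by
      have h2 : st.2 / c n ≤ st.2 / B := by gcongr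
      calc (1 - 2 / B) * (st.2 / ∏ k ∈ Finset.range l, c (n + k))
          ≤ (1 - 2 / B) * st.2 := by gcongr; exact div_le_self hst (hprod l)
        _ = st.2 - 2 * (st.2 / B) := by ring
        _ ≤ _ := by linarith
    have hv' := moranCyl_subset hc2 v (n := n + 1) (by omega)
      (st := if a then (st.1 + st.2 - st.2 / c n, st.2 / c n) else (st.1, st.2 / c n))
      (by split_ifs <;> exact hc0)
    have hw' := moranCyl_subset hc2 w (n := n + 1) (by omega)
      (st := if b then (st.1 + st.2 - st.2 / c n, st.2 / c n) else (st.1, st.2 / c n))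
      (by split_ifs <;> exact hc0)
    rw [moranCyl] at hy hz
    obtain ⟨hy1, hy2⟩ := hy
    obtain ⟨hz1, hz2⟩ := hz
    by_cases hab : a = b
    · subst hab
      cases l with
      | zero => simp_all
      | succ l =>
        have key := ih l (by omega) (v := v) (w := w) (by simpa using hv) (by simpa using hw)
          (fun h => hvw (by rw [h])) (n := n + 1) (by omega) (by split_ifs <;> exact hc0)
          ⟨hy1, hy2⟩ ⟨hz1, hz2⟩
        refine le_trans (le_of_eq ?_) key
        rw [Finset.prod_range_succ']
        simp only [add_zero, add_assoc, add_comm 1]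
        split_ifs <;> rw [div_div, mul_comm (c n)]
    · refine hgap.trans ?_
      cases a <;> cases b <;> simp only [Bool.false_eq_true, if_false, if_true, not_true] at *
      · rw [abs_sub_comm]; exact le_trans (by linarith) (le_abs_self _)
      · exact le_trans (by linarith) (le_abs_self _)

lemma eventually_rpow_add_rpow_mul_exp_lt_one {t : ℝ} (h0 : 0 < t) (h1 : t < 1) (σ : ℝ) {ε : ℝ}
    (hε : 0 < ε) :
    ∀ᶠ θ in 𝓝[>] (0 : ℝ), (t ^ (1 - σ * θ) + (1 - t) ^ (1 - σ * θ)) *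
      Real.exp (-(θ * (σ * Real.binEntropy t + ε))) < 1 := by
  have h1' : 0 < 1 - t := by linarith
  set f : ℝ → ℝ := fun θ => (t ^ (1 - σ * θ) + (1 - t) ^ (1 - σ * θ)) *
      Real.exp (-(θ * (σ * Real.binEntropy t + ε))) with hf
  have hlin : HasDerivAt (fun θ : ℝ => 1 - σ * θ) (-σ) 0 := by
    simpa using ((hasDerivAt_id (0 : ℝ)).const_mul σ).const_sub 1
  have hE : HasDerivAt (fun θ : ℝ => -(θ * (σ * Real.binEntropy t + ε)))
      (-(σ * Real.binEntropy t + ε)) 0 := by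
    simpa using ((hasDerivAt_id (0 : ℝ)).mul_const (σ * Real.binEntropy t + ε)).fun_neg
  have hd : HasDerivAt f (-ε) 0 := by
    refine (((hlin.const_rpow h0).fun_add (hlin.const_rpow h1')).fun_mul hE.exp).congr_deriv ?_
    simp [Real.binEntropy]
    ring
  have hs := (hasDerivAt_iff_tendsto_slope.1 hd).mono_left
    (nhdsWithin_mono (0 : ℝ) (fun x (hx : 0 < x) => hx.ne'))
  filter_upwards [hs.eventually_lt_const (neg_lt_zero.2 hε), self_mem_nhdsWithin] with θ hθ hpos
  have hf0 : f 0 = 1 := by simp [hf]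
  have hpos : 0 < θ := hpos
  rw [slope_def_field, hf0, sub_zero, div_lt_iff₀ hpos] at hθ
  linarith

lemma liminf_log_div_log_eq {g : ℝ → ℝ} {m P h : ℕ → ℝ} {a δ : ℝ} (ha : 0 < a) (hδ0 : 0 < δ)
    (hm : ∀ n, 0 < m n) (hP : ∀ n, 2 ^ n ≤ P n) (hPmono : Monotone P)
    (hle : ∀ n ρ, ρ < δ / P n → g ρ ≤ m (n + 1)) (hge : ∀ n ρ, 1 / P n ≤ ρ → m n ≤ g ρ)
    (hlim : ∀ ε > 0, ∀ᶠ n : ℕ in atTop, |-Real.log (m n) - h n| ≤ ε * n)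
    (hha : ∀ n, a * Real.log (P n) ≤ h n)
    (hfreq : ∀ η > 0, ∃ᶠ n : ℕ in atTop, h n ≤ (a + η) * Real.log (P n)) :
    liminf (fun ρ => Real.log (g ρ) / Real.log ρ) (𝓝[>] 0) = a := by
  have hP0 : ∀ n, 0 < P n := fun n => lt_of_lt_of_le (by positivity) (hP n)
  have hlogP : ∀ n : ℕ, n * Real.log 2 ≤ Real.log (P n) := fun n => by
    rw [← Real.log_pow]; exact Real.log_le_log (by positivity) (hP n)
  have hlog2 : 0 < Real.log 2 := Real.log_pos one_lt_two
  have hPtop : Tendsto P atTop atTop :=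
    tendsto_atTop_mono hP (tendsto_pow_atTop_atTop_of_one_lt one_lt_two)
  have hlower : ∀ b, 0 ≤ b → b < a →
      ∀ᶠ ρ in 𝓝[>] (0 : ℝ), b ≤ Real.log (g ρ) / Real.log ρ := by
    intro b hb0 hb
    set ε := (a - b) * Real.log 2 / 2 with hε
    have hε0 : 0 < ε := by have := sub_pos.2 hb; positivity
    have hD : ∀ᶠ n : ℕ in atTop, b * -Real.log δ ≤ ε * n :=
      (tendsto_natCast_atTop_atTop.const_mul_atTop hε0).eventually_ge_atTop _
    obtain ⟨n₀, hn₀⟩ := eventually_atTop.1 ((hlim ε hε0).and hD)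
    filter_upwards [Ioo_mem_nhdsGT (show 0 < min 1 (δ / P n₀) from
      lt_min one_pos (div_pos hδ0 (hP0 _)))] with ρ ⟨hρ0, hρ⟩
    have hρ1 := hρ.trans_le (min_le_left _ _)
    have hρ2 := hρ.trans_le (min_le_right _ _)
    have hsmall : ∀ d > 0, ∃ n, d / P n ≤ ρ := fun d hd => by
      obtain ⟨n, hn⟩ := (hPtop.eventually_ge_atTop (d / ρ)).exists
      exact ⟨n, (div_le_comm₀ hρ0 (hP0 n)).1 hn⟩
    have hg0 : 0 < g ρ := by
      obtain ⟨k, hk⟩ := hsmall 1 one_pos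
      exact (hm k).trans_le (hge k ρ hk)
    classical
    set n := Nat.find (hsmall δ hδ0)
    have hspec : δ / P n ≤ ρ := Nat.find_spec (hsmall δ hδ0)
    have hlt : n₀ < n := by
      by_contra! hcon
      have : δ / P n₀ ≤ δ / P n :=
        div_le_div_of_nonneg_left hδ0.le (hP0 n) (hPmono hcon)
      linarith
    obtain ⟨k, hk⟩ : ∃ k, n = k + 1 := ⟨n - 1, by omega⟩
    have hmin : ρ < δ / P k := not_le.1 (Nat.find_min (hsmall δ hδ0) (by omega))
    have h1 : Real.log (g ρ) ≤ Real.log (m n) :=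
      Real.log_le_log hg0 (hk ▸ hle k ρ hmin)
    have h2 : Real.log δ - Real.log (P n) ≤ Real.log ρ := by
      rw [← Real.log_div hδ0.ne' (hP0 n).ne']
      exact Real.log_le_log (div_pos hδ0 (hP0 n)) hspec
    obtain ⟨h3, h4⟩ := hn₀ n hlt.le
    have h5 := (abs_le.1 h3).1
    have h6 := hha n
    have h7 := mul_le_mul_of_nonneg_left (hlogP n) (sub_pos.2 hb).le
    have h8 := mul_le_mul_of_nonneg_left h2 hb0
    rw [le_div_iff_of_neg (Real.log_neg hρ0 hρ1)]
    rw [hε] at h4 h5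
    nlinarith
  have hupper : ∀ b, a < b → ∃ᶠ ρ in 𝓝[>] (0 : ℝ), Real.log (g ρ) / Real.log ρ ≤ b := by
    intro b hb
    set η := (b - a) / 2 with hη
    have hη0 : 0 < η := by have := sub_pos.2 hb; positivity
    have htend : Tendsto (fun n => 1 / P n) atTop (𝓝[>] 0) := by
      simpa only [one_div, Function.comp_def] using tendsto_inv_atTop_nhdsGT_zero.comp hPtop
    refine htend.frequently (((hfreq η hη0).and_eventually
      ((hlim (η * Real.log 2) (by positivity)).and (eventually_ge_atTop 1))).mono ?_)
    rintro n ⟨h1, h2, h3⟩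
    have h3' : (1 : ℝ) ≤ n := by exact_mod_cast h3
    have h4 := hlogP n
    have h5 : 0 < Real.log (P n) := lt_of_lt_of_le (by positivity) h4
    have h6 := Real.log_le_log (hm n) (hge n _ le_rfl)
    have h7 := (abs_le.1 h2).2
    have h8 := mul_le_mul_of_nonneg_left h4 hη0.le
    have hlog : Real.log (1 / P n) = -Real.log (P n) := by rw [one_div, Real.log_inv]
    rw [div_le_iff_of_neg (by rw [hlog]; linarith)]
    refine le_trans ?_ h6
    rw [hlog]
    have : b = a + η + η := by rw [hη]; ring
    rw [this]
    nlinarith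
  apply le_antisymm
  · exact le_of_forall_gt_imp_ge_of_dense fun b hb =>
      liminf_le_of_frequently_le (hupper b hb) ⟨0, by simpa using hlower 0 le_rfl ha⟩
  · refine le_of_forall_lt_imp_le_of_dense fun b hb => ?_
    refine le_liminf_of_le (IsCoboundedUnder.of_frequently_le (hupper (a + 1) (by linarith))) ?_
    exact (hlower (max b 0) (le_max_right _ _) (max_lt hb ha)).mono
      fun ρ hρ => (le_max_left _ _).trans hρ

section MoranMeasure

variable {B : ℝ} {c r : ℕ → ℝ} {μ : Measure ℝ}

lemma disjoint_moranI (hB : 2 < B) (hc : ∀ k, 1 ≤ k → B ≤ c k) {n : ℕ} {v w : List Bool}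
    (hv : v.length = n) (hw : w.length = n) (hvw : v ≠ w) :
    Disjoint (moranI c v) (moranI c w) := by
  cases n with
  | zero => simp_all
  | succ n =>
    rw [Set.disjoint_left]
    intro x hxv hxw
    have h := moranCyl_separated hB hc n hv hw hvw le_rfl zero_le_one hxv hxw
    rw [sub_self, abs_zero] at h
    have h1 : 0 < 1 - 2 / B := by
      rw [sub_pos, div_lt_one (by linarith)]; exact hB
    have h2 : 0 < ∏ k ∈ Finset.range n, c (1 + k) :=
      Finset.prod_pos fun k _ => by linarith [hc (1 + k) (by omega)]
    exact absurd h (not_le.2 (mul_pos h1 (div_pos one_pos h2)))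

lemma ae_exists_mem_moranI [IsProbabilityMeasure μ] (hB : 2 < B) (hc : ∀ k, 1 ≤ k → B ≤ c k)
    (hr : ∀ k, 1 ≤ k → 0 < r k ∧ r k < 1)
    (hμ : ∀ w : List Bool, μ (moranI c w) = ENNReal.ofReal (cylMass r w 1 1)) (n : ℕ) :
    ∀ᵐ x ∂μ, ∃ w : List Bool, w.length = n ∧ x ∈ moranI c w := by
  have h : μ (⋃ w ∈ binWords n, moranI c w) = 1 := by
    rw [measure_biUnion_finset]
    · simp only [hμ]
      rw [← ENNReal.ofReal_sum_of_nonneg fun w _ => (cylMass_pos hr w le_rfl one_pos).le]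
      have := sum_cylMass_rpow hr 1 n le_rfl one_pos
      simp only [Real.rpow_one, one_mul, add_sub_cancel, Finset.prod_const_one] at this
      rw [this, ENNReal.ofReal_one]
    · intro v hv w hw hvw
      exact disjoint_moranI hB hc (mem_binWords.1 hv) (mem_binWords.1 hw) hvw
    · exact fun w _ => measurableSet_Icc
  have h' : (⋃ w ∈ binWords n, moranI c w) ∈ ae μ :=
    (mem_ae_iff_prob_eq_one ((binWords n).measurableSet_biUnion fun w _ => measurableSet_Icc)).2 h
  filter_upwards [h'] with x hx
  simpa [mem_binWords] using hx

lemma measure_closedBall_le_moranI [IsProbabilityMeasure μ] (hB : 2 < B)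
    (hc : ∀ k, 1 ≤ k → B ≤ c k) (hr : ∀ k, 1 ≤ k → 0 < r k ∧ r k < 1)
    (hμ : ∀ w : List Bool, μ (moranI c w) = ENNReal.ofReal (cylMass r w 1 1)) {n : ℕ}
    {w : List Bool} (hw : w.length = n + 1) {x ρ : ℝ} (hx : x ∈ moranI c w)
    (hρ : ρ < (1 - 2 / B) / ∏ k ∈ Finset.range n, c (1 + k)) :
    μ (closedBall x ρ) ≤ μ (moranI c w) := by
  refine measure_mono_ae ?_
  filter_upwards [ae_exists_mem_moranI hB hc hr hμ (n + 1)] with y ⟨v, hv, hyv⟩ hy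
  by_cases hvw : v = w
  · exact hvw ▸ hyv
  · have h := moranCyl_separated hB hc n hv hw hvw le_rfl zero_le_one hyv hx
    rw [mul_one_div] at h
    have hy : dist y x ≤ ρ := hy
    rw [Real.dist_eq] at hy
    linarith

lemma moranI_subset_closedBall {w : List Bool} {x ρ : ℝ} (hx : x ∈ moranI c w)
    (hρ : 1 / ∏ k ∈ Finset.range w.length, c (1 + k) ≤ ρ) : moranI c w ⊆ closedBall x ρ := by
  intro y hy
  have h := moranCyl_snd c w 1 (0, 1)
  obtain ⟨h1, h2⟩ := hx
  obtain ⟨h3, h4⟩ := hy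
  rw [mem_closedBall, Real.dist_eq, abs_le]
  dsimp only at h
  constructor <;> linarith

lemma ae_eventually_mul_log_cylMass_le {p q : ℝ} (hp : 0 < p ∧ p < 1) (hq : 0 < q ∧ q < 1)
    (hr : ∀ k, 1 ≤ k → r k = p ∨ r k = q)
    (hμ : ∀ w : List Bool, μ (moranI c w) = ENNReal.ofReal (cylMass r w 1 1)) (σ : ℝ) {ε : ℝ}
    (hε : 0 < ε) :
    ∀ᵐ x ∂μ, ∀ᶠ n : ℕ in atTop, ∀ w : List Bool, w.length = n → x ∈ moranI c w →
      σ * (-Real.log (cylMass r w 1 1) -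
        ∑ k ∈ Finset.range n, Real.binEntropy (r (1 + k))) ≤ ε * n := by
  have hr' : ∀ k, 1 ≤ k → 0 < r k ∧ r k < 1 := fun k hk => by
    rcases hr k hk with h | h <;> rw [h] <;> assumption
  set f : ℝ → ℝ → ℝ := fun θ t => (t ^ (1 - σ * θ) + (1 - t) ^ (1 - σ * θ)) *
      Real.exp (-(θ * (σ * Real.binEntropy t + ε))) with hf
  obtain ⟨θ, ⟨hθp, hθq⟩, hθ⟩ :=
    (((eventually_rpow_add_rpow_mul_exp_lt_one hp.1 hp.2 σ hε).and
      (eventually_rpow_add_rpow_mul_exp_lt_one hq.1 hq.2 σ hε)).and self_mem_nhdsWithin).exists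
  have hθ : 0 < θ := hθ
  set ρ := max (f θ p) (f θ q)
  have hf0 : ∀ k, 1 ≤ k → 0 ≤ f θ (r k) := fun k hk => by
    obtain ⟨h0, h1⟩ := hr' k hk
    have : 0 < 1 - r k := by linarith
    positivity
  have hfρ : ∀ k, 1 ≤ k → f θ (r k) ≤ ρ := fun k hk => by
    rcases hr k hk with h | h <;> rw [h]
    exacts [le_max_left _ _, le_max_right _ _]
  have hρ0 : 0 ≤ ρ := (hf0 1 le_rfl).trans (hfρ 1 le_rfl)
  have hρ1 : ρ < 1 := max_lt hθp hθq
  set h : ℕ → ℝ := fun n => ∑ k ∈ Finset.range n, Real.binEntropy (r (1 + k))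
  set bad : ℕ → Finset (List Bool) := fun n => (binWords n).filter fun w =>
    ε * n < σ * (-Real.log (cylMass r w 1 1) - h n)
  have hmeas : ∀ n, μ (⋃ w ∈ bad n, moranI c w) ≤ ENNReal.ofReal (ρ ^ n) := fun n => by
    refine (measure_biUnion_finset_le _ _).trans ?_
    simp only [hμ]
    rw [← ENNReal.ofReal_sum_of_nonneg fun w _ => (cylMass_pos hr' w le_rfl one_pos).le]
    refine ENNReal.ofReal_le_ofReal ?_
    set E := Real.exp (-(θ * (σ * h n + ε * n))) with hE
    calc ∑ w ∈ bad n, cylMass r w 1 1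
        ≤ ∑ w ∈ bad n, cylMass r w 1 1 ^ (1 - σ * θ) * E := by
          refine Finset.sum_le_sum fun w hw => ?_
          have hpos := cylMass_pos hr' w le_rfl one_pos
          have hw2 := (Finset.mem_filter.1 hw).2
          rw [Real.rpow_def_of_pos hpos, hE, ← Real.exp_add]
          nth_rewrite 1 [← Real.exp_log hpos]
          rw [Real.exp_le_exp]
          nlinarith
      _ ≤ ∑ w ∈ binWords n, cylMass r w 1 1 ^ (1 - σ * θ) * E := by
          refine Finset.sum_le_sum_of_subset_of_nonneg (Finset.filter_subset _ _) fun w _ _ => ?_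
          have hpos := cylMass_pos hr' w le_rfl one_pos
          positivity
      _ = ∏ k ∈ Finset.range n, f θ (r (1 + k)) := by
          rw [← Finset.sum_mul, sum_cylMass_rpow hr' _ _ le_rfl one_pos, Real.one_rpow, one_mul,
            hf, Finset.prod_mul_distrib, ← Real.exp_sum]
          congr 1
          rw [Finset.sum_neg_distrib, ← Finset.mul_sum, Finset.sum_add_distrib, ← Finset.mul_sum,
            Finset.sum_const, Finset.card_range, nsmul_eq_mul, mul_comm (n : ℝ)]
      _ ≤ ∏ _k ∈ Finset.range n, ρ :=
          Finset.prod_le_prod (fun k _ => hf0 _ (by omega)) fun k _ => hfρ _ (by omega)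
      _ = ρ ^ n := by simp
  have hsum : ∑' n, μ (⋃ w ∈ bad n, moranI c w) ≠ ⊤ := by
    refine ne_top_of_le_ne_top ?_ (ENNReal.tsum_le_tsum hmeas)
    exact (summable_geometric_of_lt_one hρ0 hρ1).tsum_ofReal_ne_top
  filter_upwards [ae_eventually_notMem hsum] with x hx
  filter_upwards [hx] with n hn w hw hxw
  by_contra! hcon
  exact hn (mem_biUnion (x := w)
    (Finset.mem_coe.2 (Finset.mem_filter.2 ⟨mem_binWords.2 hw, hcon⟩)) hxw)

lemma ae_eventually_abs_log_cylMass_sub_le {p q : ℝ} (hp : 0 < p ∧ p < 1) (hq : 0 < q ∧ q < 1)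
    (hr : ∀ k, 1 ≤ k → r k = p ∨ r k = q)
    (hμ : ∀ w : List Bool, μ (moranI c w) = ENNReal.ofReal (cylMass r w 1 1)) :
    ∀ᵐ x ∂μ, ∀ ε > 0, ∀ᶠ n : ℕ in atTop, ∀ w : List Bool, w.length = n → x ∈ moranI c w →
      |-Real.log (cylMass r w 1 1) -
        ∑ k ∈ Finset.range n, Real.binEntropy (r (1 + k))| ≤ ε * n := by
  have h : ∀ᵐ x ∂μ, ∀ j : ℕ, ∀ᶠ n : ℕ in atTop, ∀ w : List Bool, w.length = n → x ∈ moranI c w →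
      |-Real.log (cylMass r w 1 1) -
        ∑ k ∈ Finset.range n, Real.binEntropy (r (1 + k))| ≤ 1 / ((j : ℝ) + 1) * n := by
    refine ae_all_iff.2 fun j => ?_
    have hj : 0 < 1 / ((j : ℝ) + 1) := by positivity
    filter_upwards [ae_eventually_mul_log_cylMass_le hp hq hr hμ 1 hj,
      ae_eventually_mul_log_cylMass_le hp hq hr hμ (-1) hj] with x hx hx'
    filter_upwards [hx, hx'] with n hn hn' w hw hxw
    have h1 := hn w hw hxw
    have h2 := hn' w hw hxw
    exact abs_le.2 ⟨by linarith, by linarith⟩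
  filter_upwards [h] with x hx ε hε
  obtain ⟨j, hj⟩ := exists_nat_one_div_lt hε
  filter_upwards [hx j] with n hn w hw hxw
  exact (hn w hw hxw).trans (by gcongr)

end MoranMeasure

lemma exists_parity_block {A B p q : ℝ} {N : ℕ → ℕ} {c r : ℕ → ℝ} (hN0 : N 0 = 0)
    (hNmono : StrictMono N)
    (hcA : ∀ i n : ℕ, N (2 * i) < n → n ≤ N (2 * i + 1) → c n = A)
    (hcB : ∀ i n : ℕ, N (2 * i + 1) < n → n ≤ N (2 * i + 2) → c n = B)
    (hrp : ∀ i n : ℕ, N (2 * i) < n → n ≤ N (2 * i + 1) → r n = p)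
    (hrq : ∀ i n : ℕ, N (2 * i + 1) < n → n ≤ N (2 * i + 2) → r n = q)
    {n : ℕ} (hn : 1 ≤ n) : (c n = A ∧ r n = p) ∨ (c n = B ∧ r n = q) := by
  obtain ⟨j, hj1, hj2⟩ : ∃ j, N j < n ∧ n ≤ N (j + 1) := by
    classical
    have hex : ∃ j, n ≤ N j := ⟨n, hNmono.le_apply⟩
    have hpos : Nat.find hex ≠ 0 := fun h => by
      have := Nat.find_spec hex
      rw [h] at this
      omega
    obtain ⟨j, hj⟩ := Nat.exists_eq_succ_of_ne_zero hpos
    have hspec := Nat.find_spec hex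
    rw [hj] at hspec
    exact ⟨j, not_le.1 (Nat.find_min hex (by omega)), hspec⟩
  rcases Nat.even_or_odd' j with ⟨i, rfl | rfl⟩
  · exact Or.inl ⟨hcA i n hj1 hj2, hrp i n hj1 hj2⟩
  · exact Or.inr ⟨hcB i n hj1 hj2, hrq i n hj1 hj2⟩

/-- for μ-almost every x ∈ X = supp(μ), the lower local dimension equals
H(p)/log A, where H(p) = −p log p − (1−p) log(1−p). -/
theorem stmt_3 (A B p q : ℝ) (N : ℕ → ℕ)
    (hBA : B < A) (hB2 : 2 < B)
    (hp0 : 0 < p) (hp2 : p ≤ 1 / 2) (hq0 : 0 < q) (hq2 : q ≤ 1 / 2)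
    (hN0 : N 0 = 0) (hNmono : StrictMono N)
    (hNlim : Tendsto (fun i : ℕ => (N (i + 1) : ℝ) / (N i : ℝ)) atTop atTop)
    (hpq : -Real.log p / Real.log A < -Real.log (1 - q) / Real.log B)
    (c r : ℕ → ℝ)
    (hcA : ∀ i n : ℕ, N (2 * i) < n → n ≤ N (2 * i + 1) → c n = A)
    (hcB : ∀ i n : ℕ, N (2 * i + 1) < n → n ≤ N (2 * i + 2) → c n = B)
    (hrp : ∀ i n : ℕ, N (2 * i) < n → n ≤ N (2 * i + 1) → r n = p)
    (hrq : ∀ i n : ℕ, N (2 * i + 1) < n → n ≤ N (2 * i + 2) → r n = q)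
    (μ : Measure ℝ) [IsProbabilityMeasure μ]
    (hμ : ∀ w : List Bool, μ (moranI c w) = ENNReal.ofReal (cylMass r w 1 1))
    :
    ∀ᵐ x ∂μ, lowerLocalDim μ x =
      (-(p * Real.log p) - (1 - p) * Real.log (1 - p)) / Real.log A := by
  have hA2 : 2 < A := hB2.trans hBA
  have hlogA : 0 < Real.log A := Real.log_pos (by linarith)
  have hlogB : 0 < Real.log B := Real.log_pos (by linarith)
  have hp1 : p < 1 := by linarith
  have hq1 : q < 1 := by linarith
  have hcr := fun n (hn : 1 ≤ n) =>
    exists_parity_block hN0 hNmono hcA hcB hrp hrq hn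
  have hc : ∀ k, 1 ≤ k → B ≤ c k := fun k hk => by
    rcases hcr k hk with h | h <;> rw [h.1]
    exact hBA.le
  have hr : ∀ k, 1 ≤ k → r k = p ∨ r k = q := fun k hk => (hcr k hk).imp And.right And.right
  have hr' : ∀ k, 1 ≤ k → 0 < r k ∧ r k < 1 := fun k hk => by
    rcases hr k hk with h | h <;> rw [h] <;> constructor <;> assumption
  have hH : ∀ t, -(t * Real.log t) - (1 - t) * Real.log (1 - t) = Real.binEntropy t := fun t => by
    rw [Real.binEntropy, Real.log_inv, Real.log_inv]; ring
  rw [hH]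
  set a := Real.binEntropy p / Real.log A with ha
  have ha0 : 0 < a := div_pos (Real.binEntropy_pos hp0 hp1) hlogA
  have haA : a * Real.log A = Real.binEntropy p := div_mul_cancel₀ _ hlogA.ne'
  have haB : a * Real.log B ≤ Real.binEntropy q := by
    have hpH : Real.binEntropy p ≤ -Real.log p := by
      have := Real.log_le_log hp0 (show p ≤ 1 - p by linarith)
      rw [← hH]
      nlinarith
    have hqH : -Real.log (1 - q) ≤ Real.binEntropy q := by
      have := Real.log_le_log hq0 (show q ≤ 1 - q by linarith)
      rw [← hH]
      nlinarith
    have h1 : a < -Real.log (1 - q) / Real.log B :=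
      lt_of_le_of_lt (div_le_div_of_nonneg_right hpH hlogA.le) hpq
    rw [lt_div_iff₀ hlogB] at h1
    linarith
  have hc0 : ∀ k, c (1 + k) ≠ 0 := fun k =>
    ne_of_gt (by linarith [hc (1 + k) (by omega)])
  set P : ℕ → ℝ := fun n => ∏ k ∈ Finset.range n, c (1 + k) with hP
  set h : ℕ → ℝ := fun n => ∑ k ∈ Finset.range n, Real.binEntropy (r (1 + k))
  set d : ℕ → ℝ := fun k => Real.binEntropy (r (1 + k)) - a * Real.log (c (1 + k)) with hd
  have hsub : ∀ n, h n - a * Real.log (P n) = ∑ k ∈ Finset.range n, d k := fun n => by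
    rw [hP, Real.log_prod fun k _ => hc0 k, Finset.mul_sum, ← Finset.sum_sub_distrib]
  have hd0 : ∀ k, 0 ≤ d k := fun k => by
    rcases hcr (1 + k) (by omega) with ⟨h1, h2⟩ | ⟨h1, h2⟩ <;> simp only [hd, h1, h2] <;> linarith
  have hdK : ∀ k, d k ≤ Real.binEntropy q - a * Real.log B := fun k => by
    rcases hcr (1 + k) (by omega) with ⟨h1, h2⟩ | ⟨h1, h2⟩ <;> simp only [hd, h1, h2] <;> linarith
  have hP2 : ∀ n, 2 ^ n ≤ P n := fun n => by
    calc (2 : ℝ) ^ n = ∏ _k ∈ Finset.range n, (2 : ℝ) := by simp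
      _ ≤ P n := Finset.prod_le_prod (fun _ _ => zero_le_two) fun k _ =>
        hB2.le.trans (hc (1 + k) (by omega))
  have hPmono : Monotone P := monotone_nat_of_le_succ fun n => by
    simp only [hP, Finset.prod_range_succ]
    exact le_mul_of_one_le_right ((by positivity : (0 : ℝ) ≤ 2 ^ n).trans (hP2 n))
      (by linarith [hc (1 + n) (by omega)])
  have hha : ∀ n, a * Real.log (P n) ≤ h n := fun n =>
    sub_nonneg.1 (hsub n ▸ Finset.sum_nonneg fun k _ => hd0 k)
  have hfreq : ∀ η > 0, ∃ᶠ n : ℕ in atTop, h n ≤ (a + η) * Real.log (P n) := by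
    intro η hη
    have hodd : Tendsto (fun i => N (2 * i + 1)) atTop atTop :=
      hNmono.tendsto_atTop.comp
        (tendsto_atTop_mono (fun i : ℕ => (by omega : i ≤ 2 * i + 1)) tendsto_id)
    have hratio := (hNlim.comp (tendsto_atTop_mono (fun i : ℕ => (by omega : i ≤ 2 * i))
      tendsto_id)).eventually_ge_atTop ((Real.binEntropy q - a * Real.log B) / (η * Real.log 2))
    refine hodd.frequently ((hratio.and (eventually_ge_atTop 1)).mono ?_).frequently
    rintro i ⟨hi, hi1⟩
    have hNpos : (0 : ℝ) < N (2 * i) := by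
      exact_mod_cast hN0 ▸ hNmono (show 0 < 2 * i by omega)
    have hsum : ∑ k ∈ Finset.range (N (2 * i + 1)), d k ≤
        N (2 * i) * (Real.binEntropy q - a * Real.log B) := by
      rw [← Finset.sum_subset (Finset.range_mono (hNmono (Nat.lt_add_one (2 * i))).le)]
      · simpa using Finset.sum_le_card_nsmul (Finset.range (N (2 * i))) d _ fun k _ => hdK k
      · intro k hk1 hk2
        rw [Finset.mem_range] at hk1 hk2
        simp only [hd]
        rw [hcA i (1 + k) (by omega) (by omega), hrp i (1 + k) (by omega) (by omega), haA, sub_self]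
    rw [← hsub] at hsum
    have hlog2 : 0 < Real.log 2 := Real.log_pos one_lt_two
    have hi' : (Real.binEntropy q - a * Real.log B) * N (2 * i) ≤
        N (2 * i + 1) * (η * Real.log 2) :=
      (div_le_div_iff₀ (mul_pos hη hlog2) hNpos).1 hi
    have hlogP : N (2 * i + 1) * Real.log 2 ≤ Real.log (P (N (2 * i + 1))) := by
      rw [← Real.log_pow]; exact Real.log_le_log (by positivity) (hP2 _)
    have := mul_le_mul_of_nonneg_left hlogP hη.le
    linarith
  have hδ0 : 0 < 1 - 2 / B := by
    rw [sub_pos, div_lt_one (by linarith)]; exact hB2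
  filter_upwards [ae_all_iff.2 (ae_exists_mem_moranI hB2 hc hr' hμ),
    ae_eventually_abs_log_cylMass_sub_le ⟨hp0, hp1⟩ ⟨hq0, hq1⟩ hr hμ] with x hx hlim
  choose w hw hxw using hx
  have hpos : ∀ n, 0 < cylMass r (w n) 1 1 := fun n => cylMass_pos hr' _ le_rfl one_pos
  have hmass : ∀ n, (μ (moranI c (w n))).toReal = cylMass r (w n) 1 1 := fun n => by
    rw [hμ, ENNReal.toReal_ofReal (hpos n).le]
  refine liminf_log_div_log_eq (m := fun n => cylMass r (w n) 1 1) (P := P) (h := h)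
    ha0 hδ0 hpos hP2 hPmono ?_ ?_ ?_ hha hfreq
  · intro n ρ hρ
    rw [← hmass]
    exact ENNReal.toReal_mono (measure_ne_top _ _)
      (measure_closedBall_le_moranI hB2 hc hr' hμ (hw _) (hxw _) hρ)
  · intro n ρ hρ
    simp only [← hmass]
    refine ENNReal.toReal_mono (measure_ne_top _ _) (measure_mono ?_)
    exact moranI_subset_closedBall (hxw n) (by rwa [hw n])
  · intro ε hε
    filter_upwards [hlim ε hε] with n hn
    exact hn (w n) (hw n) (hxw n)
end

section
/- The Hausdorff dimension of the Moran set X equals dim_H X = log 2 / log A. -/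
open MeasureTheory Filter Set Metric Topology

theorem moranCyl_append_singleton (c : ℕ → ℝ) (w : List Bool) (a : Bool) (n : ℕ) (st : ℝ × ℝ) :
    moranCyl c (w ++ [a]) n st =
      (if a then (moranCyl c w n st).1 + (moranCyl c w n st).2
            - (moranCyl c w n st).2 / c (n + w.length)
        else (moranCyl c w n st).1,
       (moranCyl c w n st).2 / c (n + w.length)) := by
  induction w generalizing n st with
  | nil => cases a <;> simp [moranCyl]
  | cons x w ih =>
    rw [List.cons_append, moranCyl, ih, moranCyl, List.length_cons,
      show n + 1 + w.length = n + (w.length + 1) by ring]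

/-- The common length of the basic intervals of order `n`. -/
noncomputable def moranScale (c : ℕ → ℝ) (n : ℕ) : ℝ :=
  ∏ i ∈ Finset.range n, (c (i + 1))⁻¹

theorem moranScale_succ (c : ℕ → ℝ) (n : ℕ) :
    moranScale c (n + 1) = moranScale c n / c (1 + n) := by
  rw [moranScale, Finset.prod_range_succ, moranScale, div_eq_mul_inv, add_comm 1 n]

theorem moranCyl_snd_s5 (c : ℕ → ℝ) (w : List Bool) :
    (moranCyl c w 1 (0, 1)).2 = moranScale c w.length := by
  induction w using List.reverseRecOn with
  | nil => simp [moranCyl, moranScale]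
  | append_singleton w a ih =>
    rw [moranCyl_append_singleton, List.length_append, List.length_singleton, moranScale_succ, ih]

/-- The word formed by the first `n` letters of a binary sequence. -/
def initialWord (d : ℕ → Fin 2) (n : ℕ) : List Bool :=
  (List.range n).map fun i => decide (d i = 1)

theorem length_initialWord (d : ℕ → Fin 2) (n : ℕ) : (initialWord d n).length = n := by
  simp [initialWord]

theorem initialWord_succ (d : ℕ → Fin 2) (n : ℕ) :
    initialWord d (n + 1) = initialWord d n ++ [decide (d n = 1)] := by
  simp [initialWord, List.range_succ]

theorem initialWord_congr {d e : ℕ → Fin 2} {n : ℕ} (h : ∀ i < n, d i = e i) :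
    initialWord d n = initialWord e n := by
  refine List.map_congr_left fun i hi => ?_
  rw [h i (List.mem_range.1 hi)]

/-- The left endpoint of the basic interval of order `n` coded by the sequence `d`. -/
noncomputable def moranLeft (c : ℕ → ℝ) (d : ℕ → Fin 2) (n : ℕ) : ℝ :=
  (moranCyl c (initialWord d n) 1 (0, 1)).1

theorem moranLeft_succ (c : ℕ → ℝ) (d : ℕ → Fin 2) (n : ℕ) :
    moranLeft c d (n + 1) =
      if d n = 1 then moranLeft c d n + moranScale c n - moranScale c (n + 1)
      else moranLeft c d n := by
  simp only [moranLeft, initialWord_succ, moranCyl_append_singleton, moranCyl_snd_s5,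
    length_initialWord, moranScale_succ, decide_eq_true_eq]

theorem moranI_initialWord (c : ℕ → ℝ) (d : ℕ → Fin 2) (n : ℕ) :
    moranI c (initialWord d n) = Icc (moranLeft c d n) (moranLeft c d n + moranScale c n) := by
  rw [moranI, moranCyl_snd_s5, length_initialWord, moranLeft]

/-- The point of the Moran set coded by the sequence `d`. -/
noncomputable def moranPoint (c : ℕ → ℝ) (d : ℕ → Fin 2) : ℝ :=
  ⨆ n, moranLeft c d n

theorem moranScale_pos {c : ℕ → ℝ} (hc : ∀ n, 1 ≤ c (n + 1)) (n : ℕ) : 0 < moranScale c n :=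
  Finset.prod_pos fun i _ => inv_pos.2 (zero_lt_one.trans_le (hc i))

theorem moranScale_succ_le {c : ℕ → ℝ} (hc : ∀ n, 1 ≤ c (n + 1)) (n : ℕ) :
    moranScale c (n + 1) ≤ moranScale c n := by
  rw [moranScale_succ, add_comm]
  exact div_le_self (moranScale_pos hc n).le (hc n)

theorem moranPoint_mem_Icc {c : ℕ → ℝ} (hc : ∀ n, 1 ≤ c (n + 1)) (d : ℕ → Fin 2) (n : ℕ) :
    moranPoint c d ∈ Icc (moranLeft c d n) (moranLeft c d n + moranScale c n) := by
  have h := Monotone.ciSup_mem_iInter_Icc_of_antitone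
    (f := moranLeft c d) (g := fun n => moranLeft c d n + moranScale c n) ?_ ?_ ?_
  · exact mem_iInter.1 h n
  · refine monotone_nat_of_le_succ fun n => ?_
    rw [moranLeft_succ]
    have := moranScale_succ_le hc n
    split_ifs <;> linarith
  · refine antitone_nat_of_succ_le fun n => ?_
    rw [moranLeft_succ]
    have := moranScale_succ_le hc n
    split_ifs <;> linarith
  · intro n
    have := moranScale_pos hc n
    simp only
    linarith

theorem moranPoint_mem_moranSet {c : ℕ → ℝ} (hc : ∀ n, 1 ≤ c (n + 1)) (d : ℕ → Fin 2) :
    moranPoint c d ∈ moranSet c := by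
  refine mem_iInter.2 fun n => mem_iUnion₂.2 ⟨initialWord d n, length_initialWord d n, ?_⟩
  rw [moranI_initialWord]
  exact moranPoint_mem_Icc hc d n

theorem moranScale_sub_le_sub_moranPoint {c : ℕ → ℝ} (hc : ∀ n, 1 ≤ c (n + 1)) {d e : ℕ → Fin 2}
    {n : ℕ} (h : ∀ i < n, d i = e i) (hd : d n ≠ 1) (he : e n = 1) :
    moranScale c n - 2 * moranScale c (n + 1) ≤ moranPoint c e - moranPoint c d := by
  have h1 := (moranPoint_mem_Icc hc d (n + 1)).2
  have h2 := (moranPoint_mem_Icc hc e (n + 1)).1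
  rw [moranLeft_succ, if_neg hd] at h1
  rw [moranLeft_succ, if_pos he] at h2
  have h3 : moranLeft c d n = moranLeft c e n := by
    rw [moranLeft, initialWord_congr h, moranLeft]
  linarith

theorem moranScale_sub_le_abs_sub_moranPoint {c : ℕ → ℝ} (hc : ∀ n, 1 ≤ c (n + 1))
    {d e : ℕ → Fin 2} {n : ℕ} (h : ∀ i < n, d i = e i) (hn : d n ≠ e n) :
    moranScale c n - 2 * moranScale c (n + 1) ≤ |moranPoint c d - moranPoint c e| := by
  by_cases hd : d n = 1
  · have he : e n ≠ 1 := fun he => hn (hd.trans he.symm)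
    exact (moranScale_sub_le_sub_moranPoint hc (fun i hi => (h i hi).symm) he hd).trans
      (le_abs_self _)
  · have he : e n = 1 := by
      generalize d n = x at *
      generalize e n = y at *
      fin_cases x <;> fin_cases y <;> simp_all
    rw [abs_sub_comm]
    exact (moranScale_sub_le_sub_moranPoint hc h hd he).trans (le_abs_self _)

theorem inv_pow_mul_le_abs_sub_moranPoint {c : ℕ → ℝ} {A B : ℝ} (hB : 2 < B)
    (hcB : ∀ n, B ≤ c (n + 1)) (hcA : ∀ n, c (n + 1) ≤ A)
    {d e : ℕ → Fin 2} {n : ℕ} (h : ∀ i < n, d i = e i) (hn : d n ≠ e n) :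
    (A ^ n)⁻¹ * (1 - 2 / B) ≤ |moranPoint c d - moranPoint c e| := by
  have hc : ∀ n, 1 ≤ c (n + 1) := fun n => by linarith [hcB n]
  refine le_trans ?_ (moranScale_sub_le_abs_sub_moranPoint hc h hn)
  have hA : (A ^ n)⁻¹ ≤ moranScale c n := by
    rw [moranScale, ← inv_pow, ← Finset.card_range n, ← Finset.prod_const, Finset.card_range]
    refine Finset.prod_le_prod (fun i _ => ?_) fun i _ => ?_
    · have := hcB i
      have := hcA i
      exact inv_nonneg.2 (by linarith)
    · exact inv_anti₀ (by linarith [hc i]) (hcA i)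
  have hs := moranScale_pos hc n
  have h2 : moranScale c (n + 1) ≤ moranScale c n / B := by
    rw [moranScale_succ, add_comm]
    exact div_le_div_of_nonneg_left hs.le (by linarith) (hcB n)
  have h3 : 0 ≤ 1 - 2 / B := by
    rw [sub_nonneg, div_le_one (by linarith)]; exact hB.le
  calc (A ^ n)⁻¹ * (1 - 2 / B) ≤ moranScale c n * (1 - 2 / B) := by gcongr
    _ = moranScale c n - 2 * (moranScale c n / B) := by ring
    _ ≤ _ := by linarith

theorem abs_ofDigits_sub_le_rpow_moranPoint {c : ℕ → ℝ} {A B : ℝ} (hB : 2 < B)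
    (hcB : ∀ n, B ≤ c (n + 1)) (hcA : ∀ n, c (n + 1) ≤ A) (d e : ℕ → Fin 2) :
    |Real.ofDigits d - Real.ofDigits e| ≤
      ((1 - 2 / B)⁻¹) ^ (Real.log 2 / Real.log A) *
        |moranPoint c d - moranPoint c e| ^ (Real.log 2 / Real.log A) := by
  have hA1 : 1 < A := by linarith [hcB 0, hcA 0]
  have hlA : 0 < Real.log A := Real.log_pos hA1
  have hl2 : 0 < Real.log 2 := Real.log_pos one_lt_two
  have h3 : 0 < 1 - 2 / B := by
    rw [sub_pos, div_lt_one (by linarith)]; exact hB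
  by_cases hde : d = e
  · subst hde
    simp only [sub_self, abs_zero]
    positivity
  have hex : ∃ n, d n ≠ e n := Function.ne_iff.1 hde
  classical
  have hlt : ∀ i < Nat.find hex, d i = e i := fun i hi => not_not.1 (Nat.find_min hex hi)
  have hmain := inv_pow_mul_le_abs_sub_moranPoint hB hcB hcA hlt (Nat.find_spec hex)
  have hdig := Real.abs_ofDigits_sub_ofDigits_le hlt
  refine hdig.trans ?_
  set n := Nat.find hex
  rw [← Real.mul_rpow (by positivity) (abs_nonneg _)]
  have h4 : (A ^ n)⁻¹ ≤ (1 - 2 / B)⁻¹ * |moranPoint c d - moranPoint c e| := by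
    rw [inv_mul_eq_div, le_div_iff₀ h3]
    exact hmain
  have h5 : (((2 : ℕ) : ℝ) ^ n)⁻¹ = ((A ^ n)⁻¹) ^ (Real.log 2 / Real.log A) := by
    have h6 : A ^ (Real.log 2 / Real.log A) = 2 := by
      rw [Real.rpow_def_of_pos (by linarith), mul_div_cancel₀ _ hlA.ne', Real.exp_log two_pos]
    rw [Real.inv_rpow (by positivity), ← Real.rpow_natCast A n, ← Real.rpow_mul (by linarith),
      mul_comm (n : ℝ), Real.rpow_mul (by linarith), h6, Real.rpow_natCast, Nat.cast_ofNat]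
  rw [h5]
  exact Real.rpow_le_rpow (by positivity) h4 (by positivity)

theorem le_dimH_moranSet {c : ℕ → ℝ} {A B : ℝ} (hB : 2 < B)
    (hcB : ∀ n, B ≤ c (n + 1)) (hcA : ∀ n, c (n + 1) ≤ A) :
    ENNReal.ofReal (Real.log 2 / Real.log A) ≤ dimH (moranSet c) := by
  have hA1 : 1 < A := by linarith [hcB 0, hcA 0]
  have hs : 0 < Real.log 2 / Real.log A := div_pos (Real.log_pos one_lt_two) (Real.log_pos hA1)
  have h3 : 0 < 1 - 2 / B := by
    rw [sub_pos, div_lt_one (by linarith)]; exact hB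
  set s := Real.log 2 / Real.log A
  have hC : 0 ≤ ((1 - 2 / B)⁻¹) ^ s := by positivity
  set f : ℝ → ℝ := fun x => Real.ofDigits (Function.invFun (moranPoint c) x)
  have hf : HolderOnWith (((1 - 2 / B)⁻¹) ^ s).toNNReal s.toNNReal f (range (moranPoint c)) := by
    intro x hx y hy
    have key := abs_ofDigits_sub_le_rpow_moranPoint hB hcB hcA
      (Function.invFun (moranPoint c) x) (Function.invFun (moranPoint c) y)
    rw [Function.invFun_eq hx, Function.invFun_eq hy] at key
    rw [edist_dist, edist_dist, Real.coe_toNNReal _ hs.le,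
      ENNReal.ofReal_rpow_of_nonneg dist_nonneg hs.le, ← ENNReal.ofReal, ← ENNReal.ofReal_mul hC]
    exact ENNReal.ofReal_le_ofReal key
  have hsub : Icc (0 : ℝ) 1 ⊆ f '' range (moranPoint c) := by
    intro y hy
    obtain ⟨d, -, rfl⟩ := Real.ofDigits_SurjOn one_lt_two hy
    refine ⟨moranPoint c d, mem_range_self d, ?_⟩
    have key := abs_ofDigits_sub_le_rpow_moranPoint hB hcB hcA
      (Function.invFun (moranPoint c) (moranPoint c d)) d
    rw [Function.invFun_eq (f := moranPoint c) ⟨d, rfl⟩, sub_self, abs_zero,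
      Real.zero_rpow hs.ne', mul_zero] at key
    exact sub_eq_zero.1 (abs_nonpos_iff.1 key)
  have h1 : dimH (Icc (0 : ℝ) 1) = 1 := by
    rw [Real.dimH_of_nonempty_interior (by simp)]
    simp
  have h2 := (dimH_mono hsub).trans (hf.dimH_image_le (Real.toNNReal_pos.2 hs))
  have hc : ∀ n, 1 ≤ c (n + 1) := fun n => by linarith [hcB n]
  have hr : range (moranPoint c) ⊆ moranSet c := by
    rintro _ ⟨d, rfl⟩
    exact moranPoint_mem_moranSet hc d
  rw [h1, ENNReal.le_div_iff_mul_le (Or.inl (by simpa using hs)) (Or.inl ENNReal.coe_ne_top),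
    one_mul] at h2
  exact h2.trans (dimH_mono hr)

theorem ediam_moranI (c : ℕ → ℝ) (w : List Bool) :
    ediam (moranI c w) = ENNReal.ofReal (moranScale c w.length) := by
  rw [moranI, Real.ediam_Icc, moranCyl_snd_s5, add_sub_cancel_left]

theorem dimH_moranSet_le {c : ℕ → ℝ} (d : NNReal) {φ : ℕ → ℕ}
    (hpos : ∀ i, 0 ≤ moranScale c (φ i))
    (hscale : Tendsto (fun i => moranScale c (φ i)) atTop (𝓝 0))
    (hφ : ∀ᶠ i in atTop, 2 ^ φ i * moranScale c (φ i) ^ (d : ℝ) ≤ 1) :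
    dimH (moranSet c) ≤ d := by
  refine dimH_le_of_hausdorffMeasure_ne_top (ne_top_of_le_ne_top ENNReal.one_ne_top ?_)
  refine (Measure.hausdorffMeasure_le_liminf_sum (β := ℕ) (ι := fun i => List.Vector Bool (φ i)) d
    (moranSet c) (l := atTop) (fun i => ENNReal.ofReal (moranScale c (φ i))) ?_
    (fun i w => moranI c w.1) ?_ ?_).trans ?_
  · simpa using (ENNReal.tendsto_ofReal hscale)
  · refine Eventually.of_forall fun i w => ?_
    rw [ediam_moranI, w.2]
  · refine Eventually.of_forall fun i x hx => ?_
    obtain ⟨w, hw, hxw⟩ := mem_iUnion₂.1 (mem_iInter.1 hx (φ i))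
    exact mem_iUnion.2 ⟨⟨w, hw⟩, hxw⟩
  · refine liminf_le_of_frequently_le' (hφ.mono fun i hi => ?_).frequently
    have : ∀ w : List.Vector Bool (φ i), ediam (moranI c w.1) ^ (d : ℝ)
        = ENNReal.ofReal (moranScale c (φ i) ^ (d : ℝ)) := fun w => by
      rw [ediam_moranI, w.2, ENNReal.ofReal_rpow_of_nonneg (hpos i) d.coe_nonneg]
    simp only [this, Finset.sum_const, Finset.card_univ, card_vector, Fintype.card_bool,
      nsmul_eq_mul]
    rw [← ENNReal.ofReal_natCast, ← ENNReal.ofReal_mul (by positivity), ENNReal.ofReal_le_one]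
    push_cast
    exact hi

theorem StrictMono.exists_lt_le_succ {N : ℕ → ℕ} (hN : StrictMono N) (h0 : N 0 = 0) {n : ℕ}
    (hn : 0 < n) : ∃ i, N i < n ∧ n ≤ N (i + 1) := by
  classical
  have hex : ∃ j, n ≤ N j := ⟨n, hN.id_le n⟩
  obtain ⟨i, hi⟩ : ∃ i, Nat.find hex = i + 1 := by
    refine Nat.exists_eq_succ_of_ne_zero fun h => ?_
    have := Nat.find_spec hex
    rw [h, h0] at this
    omega
  refine ⟨i, not_le.1 (Nat.find_min hex (by omega)), ?_⟩
  rw [← hi]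
  exact Nat.find_spec hex

theorem two_pow_mul_moranScale_rpow_le_one {c : ℕ → ℝ} {A d : ℝ} {m n : ℕ} (hmn : m ≤ n)
    (hA : 1 < A) (hd : 0 ≤ d) (hc : ∀ n, 1 ≤ c (n + 1))
    (hcA : ∀ k, m < k → k ≤ n → c k = A)
    (h : n * Real.log 2 ≤ d * ((n - m) * Real.log A)) :
    2 ^ n * moranScale c n ^ d ≤ 1 := by
  have hL : moranScale c n ≤ (A ^ (n - m))⁻¹ := by
    rw [moranScale, ← Finset.prod_range_mul_prod_Ico _ hmn]
    have h1 : ∏ i ∈ Finset.range m, (c (i + 1))⁻¹ ≤ 1 :=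
      Finset.prod_le_one (fun i _ => inv_nonneg.2 (zero_le_one.trans (hc i)))
        fun i _ => inv_le_one_of_one_le₀ (hc i)
    have h2 : ∏ i ∈ Finset.Ico m n, (c (i + 1))⁻¹ = (A ^ (n - m))⁻¹ := by
      rw [Finset.prod_congr rfl (g := fun _ => A⁻¹), Finset.prod_const, Nat.card_Ico, inv_pow]
      intro i hi
      rw [Finset.mem_Ico] at hi
      rw [hcA (i + 1) (by omega) (by omega)]
    rw [h2]
    exact mul_le_of_le_one_left (by positivity) h1
  have hA0 : 0 < A := by linarith
  have hpos := moranScale_pos hc n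
  have h3 : moranScale c n ^ d ≤ ((A ^ (n - m))⁻¹) ^ d := Real.rpow_le_rpow hpos.le hL hd
  calc 2 ^ n * moranScale c n ^ d ≤ 2 ^ n * ((A ^ (n - m))⁻¹) ^ d := by gcongr
    _ = Real.exp (n * Real.log 2 - d * ((n - m) * Real.log A)) := by
      rw [sub_eq_add_neg, Real.exp_add, ← Real.log_pow, Real.exp_log (by positivity),
        Real.rpow_def_of_pos (by positivity), Real.log_inv, Real.log_pow, Nat.cast_sub hmn]
      congr 2
      ring
    _ ≤ 1 := Real.exp_le_one_iff.2 (by linarith)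

theorem tendsto_moranScale {c : ℕ → ℝ} {B : ℝ} (hB : 1 < B) (hcB : ∀ n, B ≤ c (n + 1)) :
    Tendsto (moranScale c) atTop (𝓝 0) := by
  have hc : ∀ n, 1 ≤ c (n + 1) := fun n => hB.le.trans (hcB n)
  refine squeeze_zero (g := fun n => (B⁻¹) ^ n) (fun n => (moranScale_pos hc n).le) (fun n => ?_)
    (tendsto_pow_atTop_nhds_zero_of_lt_one (by positivity) (inv_lt_one_of_one_lt₀ hB))
  calc moranScale c n ≤ ∏ i ∈ Finset.range n, B⁻¹ :=
        Finset.prod_le_prod (fun i _ => inv_nonneg.2 (zero_le_one.trans (hc i)))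
          fun i _ => inv_anti₀ (by linarith) (hcB i)
    _ = (B⁻¹) ^ n := by simp

/-- the Hausdorff dimension of the Moran set X equals log 2 / log A. -/
theorem stmt_5 (A B p q : ℝ) (N : ℕ → ℕ)
    (hBA : B < A) (hB2 : 2 < B)
    (hp0 : 0 < p) (hp2 : p ≤ 1 / 2) (hq0 : 0 < q) (hq2 : q ≤ 1 / 2)
    (hN0 : N 0 = 0) (hNmono : StrictMono N)
    (hNlim : Tendsto (fun i : ℕ => (N (i + 1) : ℝ) / (N i : ℝ)) atTop atTop)
    (hpq : -Real.log p / Real.log A < -Real.log (1 - q) / Real.log B)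
    (c r : ℕ → ℝ)
    (hcA : ∀ i n : ℕ, N (2 * i) < n → n ≤ N (2 * i + 1) → c n = A)
    (hcB : ∀ i n : ℕ, N (2 * i + 1) < n → n ≤ N (2 * i + 2) → c n = B)
    (hrp : ∀ i n : ℕ, N (2 * i) < n → n ≤ N (2 * i + 1) → r n = p)
    (hrq : ∀ i n : ℕ, N (2 * i + 1) < n → n ≤ N (2 * i + 2) → r n = q)
    (μ : Measure ℝ) [IsProbabilityMeasure μ]
    (hμ : ∀ w : List Bool, μ (moranI c w) = ENNReal.ofReal (cylMass r w 1 1))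
    :
    dimH (moranSet c) = ENNReal.ofReal (Real.log 2 / Real.log A) := by
  have hcases : ∀ n, c (n + 1) = A ∨ c (n + 1) = B := by
    intro n
    obtain ⟨i, h1, h2⟩ := hNmono.exists_lt_le_succ hN0 n.succ_pos
    obtain ⟨j, rfl | rfl⟩ := Nat.even_or_odd' i
    · exact Or.inl (hcA j _ h1 h2)
    · exact Or.inr (hcB j _ h1 h2)
  have hcB' : ∀ n, B ≤ c (n + 1) := fun n => by
    rcases hcases n with h | h <;> rw [h]
    exact hBA.le
  have hcA' : ∀ n, c (n + 1) ≤ A := fun n => by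
    rcases hcases n with h | h <;> rw [h]
    exact hBA.le
  have hc1 : ∀ n, 1 ≤ c (n + 1) := fun n => by linarith [hcB' n]
  have hA1 : 1 < A := by linarith
  have hlA : 0 < Real.log A := Real.log_pos hA1
  refine le_antisymm (dimH_le fun d hd => ?_) (le_dimH_moranSet hB2 hcB' hcA')
  by_contra! hlt
  obtain ⟨d', hd1, hd2⟩ := ENNReal.lt_iff_exists_nnreal_btwn.1 hlt
  have hodd : Tendsto (fun i : ℕ => 2 * i + 1) atTop atTop :=
    tendsto_atTop_mono (fun i => by simp only [id]; omega) tendsto_id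
  have heven : Tendsto (fun i : ℕ => 2 * i) atTop atTop :=
    tendsto_atTop_mono (fun i => by simp only [id]; omega) tendsto_id
  have hsd : Real.log 2 / Real.log A < d' := by
    rw [ENNReal.ofReal_lt_iff_lt_toReal (by positivity) ENNReal.coe_ne_top] at hd1
    simpa using hd1
  have hgap : 0 < d' * Real.log A - Real.log 2 := sub_pos.2 ((div_lt_iff₀ hlA).1 hsd)
  have hdim : dimH (moranSet c) ≤ d' := by
    refine dimH_moranSet_le d' (φ := fun i => N (2 * i + 1))
      (fun i => (moranScale_pos hc1 _).le)
      ((tendsto_moranScale (by linarith) hcB').comp (hNmono.tendsto_atTop.comp hodd)) ?_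
    filter_upwards [(hNlim.comp heven).eventually_ge_atTop
      (d' * Real.log A / (d' * Real.log A - Real.log 2)), eventually_ge_atTop 1] with i hi hi1
    refine two_pow_mul_moranScale_rpow_le_one (hNmono.monotone (Nat.le_succ _)) hA1 d'.coe_nonneg
      hc1 (hcA i) ?_
    have hNpos : (0 : ℝ) < N (2 * i) := by
      rw [Nat.cast_pos, ← hN0]
      exact hNmono (by omega)
    simp only [Function.comp_apply] at hi
    rw [div_le_div_iff₀ hgap hNpos] at hi
    linarith
  exact absurd hd ((hausdorffMeasure_of_dimH_lt (hdim.trans_lt hd2)).trans_ne ENNReal.zero_ne_top)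
end
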